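/- Let N and ν be nonnegative integers with N odd and ν even, or N even and ν odd. Then there exists a real polynomial Q such that F_ν^N(z) = z^{−1}·e^{−z}·Q(1/z) for all real z > 0, and deg Q ≤ ν−1 if N < ν, while deg Q ≤ N−1 if N > ν. -/

import Mathlib

open Real MeasureTheory

/-- The modified Bessel function of the second kind, for `z > 0` and real order `ν`. -/
noncomputable def besselK (ν z : ℝ) : ℝ :=
  ∫ t in Set.Ioi (0 : ℝ), Real.exp (-z * Real.cosh t) * Real.cosh (ν * t)

/-- `F_ν^N(z) = ∫_0^∞ cosh^N(t) K_ν(z cosh t) dt`. -/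
noncomputable def F (N : ℕ) (ν : ℝ) (z : ℝ) : ℝ :=
  ∫ t in Set.Ioi (0 : ℝ), Real.cosh t ^ N * besselK ν (z * Real.cosh t)

/-- Two-sided exponential integral `∫ exp (-w cosh t + a t) dt = 2 K_a(w)`. -/
noncomputable def EK (a w : ℝ) : ℝ := ∫ t : ℝ, Real.exp (-w * Real.cosh t + a * t)

lemma cosh_eq_sinh_half (t : ℝ) : Real.cosh t = 1 + 2 * Real.sinh (t / 2) ^ 2 := by
  have h := Real.cosh_two_mul (t / 2)
  have h2 := Real.cosh_sq (t / 2)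
  have h3 : 2 * (t / 2) = t := by ring
  rw [h3] at h
  rw [h, h2]; ring

lemma cosh_ge_sq (t : ℝ) : t ^ 2 / 2 ≤ Real.cosh t := by
  have h : (t / 2) ^ 2 ≤ Real.sinh (t / 2) ^ 2 := by
    rcases le_total 0 (t / 2) with h | h
    · have := Real.self_le_sinh_iff.2 h
      nlinarith
    · have := Real.sinh_le_self_iff.2 h
      nlinarith
  rw [cosh_eq_sinh_half]
  nlinarith

lemma EK_integrable (a : ℝ) {w : ℝ} (hw : 0 < w) :
    Integrable (fun t : ℝ => Real.exp (-w * Real.cosh t + a * t)) := by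
  have h1 : Integrable (fun t : ℝ => Real.exp (a ^ 2 / w) * Real.exp (-(w / 4) * t ^ 2)) :=
    (integrable_exp_neg_mul_sq (by positivity)).const_mul _
  refine h1.mono' (by fun_prop) (Filter.Eventually.of_forall fun t => ?_)
  rw [Real.norm_eq_abs, abs_of_pos (Real.exp_pos _), ← Real.exp_add]
  apply Real.exp_le_exp.2
  have h2 := mul_le_mul_of_nonneg_left (cosh_ge_sq t) hw.le
  have h3 : a * t ≤ a ^ 2 / w + w / 4 * t ^ 2 := by
    have : a ^ 2 / w + w / 4 * t ^ 2 - a * t = (a - w * t / 2) ^ 2 / w := by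
      field_simp; ring
    have : 0 ≤ (a - w * t / 2) ^ 2 / w := by positivity
    linarith
  linarith

lemma EK_neg (a w : ℝ) : EK (-a) w = EK a w := by
  unfold EK
  rw [← integral_neg_eq_self]
  congr 1; ext t
  rw [Real.cosh_neg]; ring_nf

lemma EK_rec (a : ℝ) {w : ℝ} (hw : 0 < w) :
    EK (a + 1) w = EK (a - 1) w + 2 * a / w * EK a w := by
  have hd : ∀ t : ℝ, HasDerivAt (fun t : ℝ => Real.exp (-w * Real.cosh t + a * t))
      ((-w / 2) * Real.exp (-w * Real.cosh t + (a + 1) * t)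
        + (w / 2) * Real.exp (-w * Real.cosh t + (a - 1) * t)
        + a * Real.exp (-w * Real.cosh t + a * t)) t := by
    intro t
    have h := (((Real.hasDerivAt_cosh t).const_mul (-w)).add
      ((hasDerivAt_id t).const_mul a)).exp
    refine HasDerivAt.congr_deriv (f := fun t : ℝ => Real.exp (-w * Real.cosh t + a * t)) h ?_
    have e1 : -w * Real.cosh t + (a + 1) * t = (-w * Real.cosh t + a * t) + t := by ring
    have e2 : -w * Real.cosh t + (a - 1) * t = (-w * Real.cosh t + a * t) + -t := by ring
    rw [e1, e2, Real.exp_add _ t, Real.exp_add _ (-t), Real.sinh_eq]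
    simp
    ring
  have i1 := (EK_integrable (a + 1) hw).const_mul (-w / 2)
  have i2 := (EK_integrable (a - 1) hw).const_mul (w / 2)
  have i3 := (EK_integrable a hw).const_mul a
  have h := integral_eq_zero_of_hasDerivAt_of_integrable hd ((i1.add i2).add i3)
    (EK_integrable a hw)
  have i12 : Integrable (fun t : ℝ => (-w / 2) * Real.exp (-w * Real.cosh t + (a + 1) * t)
        + (w / 2) * Real.exp (-w * Real.cosh t + (a - 1) * t)) := i1.add i2
  rw [integral_add i12 i3, integral_add i1 i2, integral_const_mul, integral_const_mul,
    integral_const_mul] at h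
  change (-w / 2) * EK (a + 1) w + (w / 2) * EK (a - 1) w + a * EK a w = 0 at h
  field_simp
  linarith

lemma EK_half {w : ℝ} (hw : 0 < w) :
    EK (1 / 2) w = 2 * Real.exp (-w) * √(π / (2 * w)) := by
  have hsym : EK (1 / 2) w = ∫ t : ℝ, Real.exp (-w * Real.cosh t) * Real.cosh (t / 2) := by
    have h1 : EK (1 / 2) w = (EK (1 / 2) w + EK (-(1 / 2)) w) / 2 := by rw [EK_neg]; ring
    rw [h1]; unfold EK
    rw [← integral_add (EK_integrable _ hw) (EK_integrable _ hw), ← integral_div]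
    congr 1; ext t
    rw [Real.exp_add, Real.exp_add, Real.cosh_eq (t / 2)]
    ring_nf
  have hcv := integral_image_eq_integral_abs_deriv_smul (s := Set.univ)
    (f := fun t : ℝ => Real.sinh (t / 2)) (f' := fun t => Real.cosh (t / 2) / 2)
    MeasurableSet.univ
    (fun t _ => by
      have := ((Real.hasDerivAt_sinh (t / 2)).comp t ((hasDerivAt_id t).div_const 2))
      refine HasDerivAt.hasDerivWithinAt ?_
      exact HasDerivAt.congr_deriv (f := fun t : ℝ => Real.sinh (t / 2)) this (by ring))
    (fun x _ y _ h => by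
      have := Real.sinh_injective h
      linarith)
    (fun x => Real.exp (-(2 * w) * x ^ 2))
  have him : (fun t : ℝ => Real.sinh (t / 2)) '' Set.univ = Set.univ := by
    rw [Set.image_univ, Set.range_eq_univ]
    intro y
    obtain ⟨x, hx⟩ := Real.sinh_surjective y
    exact ⟨2 * x, by simpa using hx⟩
  rw [him, Measure.restrict_univ, integral_gaussian] at hcv
  rw [hsym, hcv, ← integral_const_mul]
  congr 1; ext t
  rw [abs_of_pos (by have := Real.cosh_pos (t / 2); positivity), cosh_eq_sinh_half t, smul_eq_mul]
  have : -w * (1 + 2 * Real.sinh (t / 2) ^ 2) = -w + -(2 * w) * Real.sinh (t / 2) ^ 2 := by ring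
  rw [this, Real.exp_add]
  ring

/-- `EK` at half-integer order and argument `z/2`. -/
lemma EK_poly_nat (n : ℕ) : ∃ P : Polynomial ℝ, P.natDegree ≤ n ∧
    ∀ z : ℝ, 0 < z → EK ((n : ℝ) + 1 / 2) (z / 2)
      = 2 * Real.exp (-(z / 2)) * √(π / z) * P.eval (1 / z) := by
  have base : ∀ z : ℝ, 0 < z → EK (1 / 2) (z / 2) = 2 * Real.exp (-(z / 2)) * √(π / z) := by
    intro z hz
    rw [EK_half (by positivity)]
    congr 3; ring
  induction n using Nat.twoStepInduction with
  | zero => exact ⟨1, by simp, fun z hz => by simpa using base z hz⟩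
  | one =>
    refine ⟨1 + Polynomial.C 2 * Polynomial.X, ?_, fun z hz => ?_⟩
    · compute_degree
    · have h := EK_rec (1 / 2) (w := z / 2) (by positivity)
      have e : (1 / 2 - 1 : ℝ) = -(1 / 2) := by norm_num
      rw [e, EK_neg, base z hz] at h
      have e2 : ((1 : ℕ) : ℝ) + 1 / 2 = 1 / 2 + 1 := by norm_num
      rw [e2, h]
      simp
      field_simp
  | more n ih0 ih1 =>
    obtain ⟨P, hP, hP'⟩ := ih0
    obtain ⟨R, hR, hR'⟩ := ih1
    refine ⟨P + Polynomial.C (4 * ((n : ℝ) + 3 / 2)) * (Polynomial.X * R), ?_, fun z hz => ?_⟩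
    · refine Polynomial.natDegree_add_le_of_degree_le (by omega) ?_
      refine (Polynomial.natDegree_C_mul_le _ _).trans ?_
      refine Polynomial.natDegree_mul_le.trans ?_
      have := Polynomial.natDegree_X_le (R := ℝ)
      omega
    · have h := EK_rec ((n : ℝ) + 3 / 2) (w := z / 2) (by positivity)
      have e1 : (n : ℝ) + 3 / 2 - 1 = n + 1 / 2 := by ring
      have e2 : (n : ℝ) + 3 / 2 = ((n + 1 : ℕ) : ℝ) + 1 / 2 := by push_cast; ring
      have e3 : ((n + 2 : ℕ) : ℝ) + 1 / 2 = (n : ℝ) + 3 / 2 + 1 := by push_cast; ring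
      have h4 := hR' z hz
      rw [← e2] at h4
      rw [e3, h, e1, hP' z hz, h4]
      simp only [Polynomial.eval_add, Polynomial.eval_mul, Polynomial.eval_C, Polynomial.eval_X]
      field_simp
      ring

lemma EK_poly (j : ℤ) (hj : Odd j) : ∃ P : Polynomial ℝ, P.natDegree ≤ (j.natAbs - 1) / 2 ∧
    ∀ z : ℝ, 0 < z → EK ((j : ℝ) / 2) (z / 2)
      = 2 * Real.exp (-(z / 2)) * √(π / z) * P.eval (1 / z) := by
  obtain ⟨m, hm⟩ := hj
  rcases le_total 0 m with h | h
  · obtain ⟨n, rfl⟩ := Int.eq_ofNat_of_zero_le h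
    obtain ⟨P, hP, hP'⟩ := EK_poly_nat n
    refine ⟨P, by omega, fun z hz => ?_⟩
    rw [← hP' z hz, hm]; congr 1; push_cast; ring
  · rcases eq_or_lt_of_le h with h0 | h0
    · obtain ⟨P, hP, hP'⟩ := EK_poly_nat 0
      refine ⟨P, by omega, fun z hz => ?_⟩
      rw [← hP' z hz, hm, h0]; congr 1; norm_num
    · obtain ⟨n, hn⟩ := Int.eq_ofNat_of_zero_le (show 0 ≤ -m - 1 by omega)
      obtain ⟨P, hP, hP'⟩ := EK_poly_nat n
      refine ⟨P, by omega, fun z hz => ?_⟩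
      have hmn : m = -(n : ℤ) - 1 := by omega
      rw [← hP' z hz, hm, ← EK_neg, hmn]; congr 1; push_cast; ring

/-- the sheared two-dimensional integrand -/
noncomputable def shear (μ ν z t u : ℝ) : ℝ :=
  Real.exp (-(z / 2) * Real.cosh u + (μ + ν) / 2 * u)
    * Real.exp (-(z / 2) * Real.cosh (2 * t - u) + (μ - ν) / 2 * (2 * t - u))

lemma shear_inner_integrable (μ ν : ℝ) {z : ℝ} (hz : 0 < z) (u : ℝ) :
    Integrable (fun t => shear μ ν z t u) := by
  unfold shear
  refine Integrable.const_mul ?_ _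
  have h := EK_integrable ((μ - ν) / 2) (w := z / 2) (by positivity)
  exact (h.comp_sub_right u).comp_mul_left' (R := 2) (by norm_num)

lemma shear_inner (μ ν z u : ℝ) :
    ∫ t, shear μ ν z t u = Real.exp (-(z / 2) * Real.cosh u + (μ + ν) / 2 * u)
      * (EK ((μ - ν) / 2) (z / 2) / 2) := by
  unfold shear
  rw [integral_const_mul]
  congr 1
  have h1 := Measure.integral_comp_mul_left (fun t : ℝ =>
    Real.exp (-(z / 2) * Real.cosh (t - u) + (μ - ν) / 2 * (t - u))) 2
  rw [h1, integral_sub_right_eq_self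
    (fun t : ℝ => Real.exp (-(z / 2) * Real.cosh t + (μ - ν) / 2 * t)) u]
  change |(2 : ℝ)⁻¹| • EK ((μ - ν) / 2) (z / 2) = _
  rw [abs_of_pos (by norm_num), smul_eq_mul]; ring

lemma shear_integrable (μ ν : ℝ) {z : ℝ} (hz : 0 < z) :
    Integrable (fun p : ℝ × ℝ => shear μ ν z p.1 p.2) (volume.prod volume) := by
  have hm : AEStronglyMeasurable (fun p : ℝ × ℝ => shear μ ν z p.1 p.2)
      (volume.prod volume) := by
    apply Continuous.aestronglyMeasurable
    unfold shear
    fun_prop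
  rw [integrable_prod_iff' hm]
  refine ⟨Filter.Eventually.of_forall fun u => shear_inner_integrable μ ν hz u, ?_⟩
  have : (fun u => ∫ t, ‖shear μ ν z t u‖) = fun u => ∫ t, shear μ ν z t u := by
    ext u; congr 1; ext t
    rw [Real.norm_eq_abs, abs_of_pos]; unfold shear; positivity
  change Integrable (fun u => ∫ t, ‖shear μ ν z t u‖)
  rw [this]
  simp_rw [shear_inner]
  exact (EK_integrable _ (by positivity)).mul_const _

lemma shear_outer (μ ν z t : ℝ) :
    ∫ u, shear μ ν z t u = Real.exp (μ * t) * EK ν (z * Real.cosh t) := by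
  unfold EK
  rw [← integral_const_mul, ← integral_sub_right_eq_self (fun s : ℝ =>
    Real.exp (μ * t) * Real.exp (-(z * Real.cosh t) * Real.cosh s + ν * s)) t]
  congr 1; ext u
  unfold shear
  rw [← Real.exp_add, ← Real.exp_add]
  congr 1
  obtain ⟨s, rfl⟩ : ∃ s, u = t + s := ⟨u - t, by ring⟩
  have e1 : 2 * t - (t + s) = t - s := by ring
  have e2 : t + s - t = s := by ring
  rw [e1, e2, Real.cosh_add, Real.cosh_sub]
  ring

lemma outer_integrable (μ ν : ℝ) {z : ℝ} (hz : 0 < z) :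
    Integrable (fun t => Real.exp (μ * t) * EK ν (z * Real.cosh t)) := by
  have := (shear_integrable μ ν hz).integral_prod_left
  simpa only [shear_outer] using this

lemma outer_integral (μ ν : ℝ) {z : ℝ} (hz : 0 < z) :
    ∫ t, Real.exp (μ * t) * EK ν (z * Real.cosh t)
      = EK ((μ + ν) / 2) (z / 2) * EK ((μ - ν) / 2) (z / 2) / 2 := by
  have h := integral_integral_swap (f := fun t u => shear μ ν z t u) (shear_integrable μ ν hz)
  simp_rw [shear_outer, shear_inner] at h
  rw [h, integral_mul_const]
  change EK _ _ * _ = _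
  ring

lemma besselK_eq (ν : ℝ) {w : ℝ} (hw : 0 < w) : besselK ν w = EK ν w / 2 := by
  have h := integral_comp_abs (f := fun t : ℝ => Real.exp (-w * Real.cosh t) * Real.cosh (ν * t))
  have h1 : EK ν w = (EK ν w + EK (-ν) w) / 2 := by rw [EK_neg]; ring
  have h2 : EK ν w = 2 * besselK ν w := by
    unfold besselK
    rw [← h, h1]; unfold EK
    rw [← integral_add (EK_integrable _ hw) (EK_integrable _ hw), ← integral_div]
    congr 1; ext t
    have : Real.cosh (ν * |t|) = Real.cosh (ν * t) := by
      rcases abs_choice t with h | h <;> rw [h]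
      rw [mul_neg, Real.cosh_neg]
    rw [this, Real.cosh_abs, Real.exp_add, Real.exp_add, Real.cosh_eq (ν * t)]
    ring_nf
  rw [h2]; ring

lemma F_eq (N : ℕ) (ν : ℝ) {z : ℝ} (hz : 0 < z) :
    F N ν z = ∑ k ∈ Finset.range (N + 1), (N.choose k : ℝ) / 2 ^ N / 8 *
      (EK (((2 * k - N : ℝ) + ν) / 2) (z / 2) * EK (((2 * k - N : ℝ) - ν) / 2) (z / 2)) := by
  have h := integral_comp_abs
    (f := fun t : ℝ => Real.cosh t ^ N * besselK ν (z * Real.cosh t))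
  have h1 : F N ν z = (∫ t : ℝ, Real.cosh t ^ N * besselK ν (z * Real.cosh t)) / 2 := by
    unfold F
    simp only [Real.cosh_abs] at h
    rw [h]; ring
  have h2 : ∀ t : ℝ, Real.cosh t ^ N * besselK ν (z * Real.cosh t)
      = ∑ k ∈ Finset.range (N + 1), (N.choose k : ℝ) / 2 ^ N / 2 *
        (Real.exp ((2 * k - N : ℝ) * t) * EK ν (z * Real.cosh t)) := by
    intro t
    rw [besselK_eq ν (mul_pos hz (Real.cosh_pos t)), Real.cosh_eq t, div_pow, add_pow,
      Finset.sum_div, Finset.sum_mul]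
    refine Finset.sum_congr rfl fun k hk => ?_
    have hk' : k ≤ N := by simpa [Nat.lt_succ_iff] using hk
    have : Real.exp t ^ k * Real.exp (-t) ^ (N - k) = Real.exp ((2 * k - N : ℝ) * t) := by
      rw [← Real.exp_nat_mul, ← Real.exp_nat_mul, ← Real.exp_add, Nat.cast_sub hk']
      congr 1; ring
    rw [this]; ring
  rw [h1]
  simp_rw [h2]
  rw [integral_finsetSum _ fun k _ => (outer_integrable _ ν hz).const_mul _, Finset.sum_div]
  refine Finset.sum_congr rfl fun k _ => ?_
  rw [integral_const_mul, outer_integral _ ν hz]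
  ring

theorem F_polynomial_degree (N ν : ℕ)
    (h : (Odd N ∧ Even ν) ∨ (Even N ∧ Odd ν)) :
    ∃ Q : Polynomial ℝ,
      (∀ z : ℝ, 0 < z → F N (ν : ℝ) z = z⁻¹ * Real.exp (-z) * Q.eval (1 / z)) ∧
      (N < ν → Q.natDegree ≤ ν - 1) ∧
      (ν < N → Q.natDegree ≤ N - 1) := by
  have key : ∀ k : ℕ, ∃ P : Polynomial ℝ, (k ∈ Finset.range (N + 1) →
      P.natDegree ≤ max N ν - 1) ∧ ∀ z : ℝ, 0 < z →
      EK (((2 * k - N : ℝ) + ν) / 2) (z / 2) * EK (((2 * k - N : ℝ) - ν) / 2) (z / 2)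
        = z⁻¹ * Real.exp (-z) * P.eval (1 / z) := by
    intro k
    have ho : (N + ν) % 2 = 1 := by
      rcases h with ⟨h1, h2⟩ | ⟨h1, h2⟩
      · rw [Nat.odd_iff] at h1; rw [Nat.even_iff] at h2; omega
      · rw [Nat.even_iff] at h1; rw [Nat.odd_iff] at h2; omega
    obtain ⟨P, hP, hP'⟩ := EK_poly (2 * k - N + ν) (by rw [Int.odd_iff]; omega)
    obtain ⟨R, hR, hR'⟩ := EK_poly (2 * k - N - ν) (by rw [Int.odd_iff]; omega)
    refine ⟨Polynomial.C (4 * π) * (P * R), fun hk => ?_, fun z hz => ?_⟩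
    · refine (Polynomial.natDegree_C_mul_le _ _).trans (Polynomial.natDegree_mul_le.trans ?_)
      rw [Finset.mem_range] at hk
      omega
    · have a1 := hP' z hz
      have a2 := hR' z hz
      push_cast at a1 a2
      rw [a1, a2]
      have hs : √(π / z) * √(π / z) = π / z := Real.mul_self_sqrt (by positivity)
      have he : Real.exp (-z) = Real.exp (-(z / 2)) * Real.exp (-(z / 2)) := by
        rw [← Real.exp_add]; congr 1; ring
      rw [he]
      simp only [Polynomial.eval_mul, Polynomial.eval_C]
      calc _ = 4 * (Real.exp (-(z / 2)) * Real.exp (-(z / 2))) * (√(π / z) * √(π / z))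
            * (P.eval (1 / z) * R.eval (1 / z)) := by ring
        _ = _ := by rw [hs]; ring
  choose P hP hP' using key
  have hdeg : (∑ k ∈ Finset.range (N + 1),
      Polynomial.C ((N.choose k : ℝ) / 2 ^ N / 8) * P k).natDegree ≤ max N ν - 1 :=
    Polynomial.natDegree_sum_le_of_forall_le _ _ fun k hk =>
      (Polynomial.natDegree_C_mul_le _ _).trans (hP k hk)
  refine ⟨∑ k ∈ Finset.range (N + 1), Polynomial.C ((N.choose k : ℝ) / 2 ^ N / 8) * P k,
    fun z hz => ?_, fun hlt => by omega, fun hlt => by omega⟩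
  rw [F_eq N ν hz, Polynomial.eval_finsetSum, Finset.mul_sum]
  refine Finset.sum_congr rfl fun k _ => ?_
  rw [hP' k z hz, Polynomial.eval_mul, Polynomial.eval_C]
  ring
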